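/- On a path of m items, for any number n of agents with identical monotonic valuations (all agents share one monotonic valuation u), there exists a connected allocation that is simultaneously EF1 and MMS (every agent's bundle has value at least the common maximin share). -/

import Mathlib

/-- A bundle of items on a path (modeled as `Fin m`) is connected iff it is an interval
(possibly empty). -/
def IsInterval {m : ℕ} (I : Finset (Fin m)) : Prop :=
  ∀ a b c : Fin m, a ≤ b → b ≤ c → a ∈ I → c ∈ I → b ∈ I

/-- A valuation is monotonic if larger bundles are weakly better. -/
def Monotonic {m : ℕ} (u : Finset (Fin m) → ℝ) : Prop :=
  ∀ X Y : Finset (Fin m), X ⊆ Y → u X ≤ u Y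

/-- A connected allocation on a path: every bundle is an interval, bundles are pairwise
disjoint, and every item belongs to some bundle. -/
def IsConnAlloc {n m : ℕ} (A : Fin n → Finset (Fin m)) : Prop :=
  (∀ i, IsInterval (A i)) ∧ (∀ i j, i ≠ j → Disjoint (A i) (A j)) ∧
    ∀ v : Fin m, ∃ i, v ∈ A i

/-- EF1 (envy-freeness up to one outer good) on a path. -/
def EF1 {n m : ℕ} (u : Fin n → Finset (Fin m) → ℝ) (A : Fin n → Finset (Fin m)) : Prop :=
  ∀ i j : Fin n, A j = ∅ ∨
    ∃ v ∈ A j, IsInterval (A j \ {v}) ∧ u i (A j \ {v}) ≤ u i (A i)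

/-- The maximin share of an agent with valuation `u`, for `n` agents: the maximum, over
all partitions of the path into `n` connected bundles, of the minimum value of a bundle. -/
noncomputable def MMS (n : ℕ) {m : ℕ} (u : Finset (Fin m) → ℝ) : ℝ :=
  sSup {x : ℝ | ∃ P : Fin n → Finset (Fin m),
    IsConnAlloc P ∧ x = sInf (Set.range fun j => u (P j))}

/-- The bundle of the items that `f` assigns to agent `i`. -/
def bundle {n m : ℕ} (f : Fin m → Fin n) (i : Fin n) : Finset (Fin m) :=
  Finset.univ.filter fun v => f v = i

lemma mem_bundle {n m : ℕ} {f : Fin m → Fin n} {i : Fin n} {v : Fin m} :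
    v ∈ bundle f i ↔ f v = i := by
  simp [bundle]

lemma isConnAlloc_bundle {n m : ℕ} {f : Fin m → Fin n} (hf : Monotone f) :
    IsConnAlloc (bundle f) := by
  refine ⟨fun i a b c hab hbc ha hc => ?_, fun i j hij => ?_, fun v => ⟨f v, mem_bundle.2 rfl⟩⟩
  · rw [mem_bundle] at *
    exact le_antisymm (hc ▸ hf hbc) (ha ▸ hf hab)
  · refine Finset.disjoint_left.2 fun v hi hj => hij ?_
    rw [mem_bundle] at *
    exact hi.symm.trans hj

/-- Up to a permutation of the agents, a connected allocation assigns the items monotonically. -/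
lemma IsConnAlloc.exists_monotone {n m : ℕ} {P : Fin n → Finset (Fin m)} (hP : IsConnAlloc P) :
    ∃ f : Fin m → Fin n, Monotone f ∧ ∃ σ : Equiv.Perm (Fin n), ∀ i, bundle f i = P (σ i) := by
  classical
  obtain ⟨hint, hdisj, hcov⟩ := hP
  choose g hg using hcov
  have howner : ∀ v i, v ∈ P i → g v = i := fun v i hv => by
    by_contra hne
    exact Finset.disjoint_left.1 (hdisj _ _ hne) (hg v) hv
  let key : Fin n → ℕ := fun i => if h : (P i).Nonempty then ((P i).min' h : ℕ) else 0
  let σ := Tuple.sort key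
  refine ⟨fun v => σ.symm (g v), fun v w hvw => ?_, σ, fun i => ?_⟩
  · by_contra! hlt
    have hkey : key (g w) ≤ key (g v) := by
      simpa [σ] using Tuple.monotone_sort key hlt.le
    have hv : (P (g v)).Nonempty := ⟨v, hg v⟩
    have hw : (P (g w)).Nonempty := ⟨w, hg w⟩
    simp only [key, dif_pos hv, dif_pos hw] at hkey
    have hle : (P (g w)).min' hw ≤ v := le_trans hkey (Finset.min'_le _ _ (hg v))
    have hmem := hint (g w) _ v w hle hvw (Finset.min'_mem _ hw) (hg w)
    rw [howner v _ hmem] at hlt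
    exact lt_irrefl _ hlt
  · ext v
    rw [mem_bundle, Equiv.symm_apply_eq]
    exact ⟨fun h => h ▸ hg v, howner v _⟩

lemma finite_setOf_min_values {n m : ℕ} (u : Finset (Fin m) → ℝ) :
    {x : ℝ | ∃ P : Fin n → Finset (Fin m),
      IsConnAlloc P ∧ x = sInf (Set.range fun j => u (P j))}.Finite := by
  refine (Set.finite_range fun P : Fin n → Finset (Fin m) =>
    sInf (Set.range fun j => u (P j))).subset ?_
  rintro x ⟨P, -, rfl⟩
  exact ⟨P, rfl⟩

lemma exists_monotone_MMS_le {n m : ℕ} (hn : 0 < n) (u : Finset (Fin m) → ℝ) :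
    ∃ f : Fin m → Fin n, Monotone f ∧ ∀ i, MMS n u ≤ u (bundle f i) := by
  have hne : {x : ℝ | ∃ P : Fin n → Finset (Fin m),
      IsConnAlloc P ∧ x = sInf (Set.range fun j => u (P j))}.Nonempty :=
    ⟨_, bundle fun _ => ⟨0, hn⟩, isConnAlloc_bundle monotone_const, rfl⟩
  obtain ⟨P, hP, hMMS⟩ := hne.csSup_mem (finite_setOf_min_values u)
  obtain ⟨f, hf, σ, hσ⟩ := hP.exists_monotone
  refine ⟨f, hf, fun i => ?_⟩
  rw [hσ, MMS, hMMS]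
  exact csInf_le (Set.finite_range _).bddBelow ⟨σ i, rfl⟩

lemma IsConnAlloc.exists_le_MMS {n m : ℕ} (hn : 0 < n) (u : Finset (Fin m) → ℝ)
    {P : Fin n → Finset (Fin m)} (hP : IsConnAlloc P) : ∃ i, u (P i) ≤ MMS n u := by
  have : Nonempty (Fin n) := ⟨⟨0, hn⟩⟩
  obtain ⟨i, hi⟩ := (Set.range_nonempty fun j => u (P j)).csInf_mem (Set.finite_range _)
  exact ⟨i, hi.trans_le (le_csSup (finite_setOf_min_values u).bddAbove ⟨P, hP, rfl⟩)⟩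

lemma IsInterval.sdiff_max {m : ℕ} {I : Finset (Fin m)} (hI : IsInterval I) {v : Fin m}
    (hv : ∀ w ∈ I, w ≤ v) : IsInterval (I \ {v}) := by
  intro a b c hab hbc ha hc
  simp only [Finset.mem_sdiff, Finset.mem_singleton] at *
  refine ⟨hI a b c hab hbc ha.1 hc.1, ?_⟩
  rintro rfl
  exact hc.2 (le_antisymm (hv c hc.1) hbc)

lemma IsInterval.sdiff_min {m : ℕ} {I : Finset (Fin m)} (hI : IsInterval I) {v : Fin m}
    (hv : ∀ w ∈ I, v ≤ w) : IsInterval (I \ {v}) := by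
  intro a b c hab hbc ha hc
  simp only [Finset.mem_sdiff, Finset.mem_singleton] at *
  refine ⟨hI a b c hab hbc ha.1 hc.1, ?_⟩
  rintro rfl
  exact ha.2 (le_antisymm hab (hv a ha.1))

/-- An outer item of a bundle `j ≠ i` can be passed to the neighbouring bundle on the side
of `i`. -/
lemma exists_outer_move {n m : ℕ} {f : Fin m → Fin n} (hf : Monotone f) {i j : Fin n}
    (hij : j ≠ i) (hj : (bundle f j).Nonempty) :
    ∃ v ∈ bundle f j, IsInterval (bundle f j \ {v}) ∧
      ∃ k, Monotone (Function.update f v k) ∧ k ≠ j ∧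
        Nat.dist (k : ℕ) i < Nat.dist (j : ℕ) i := by
  have hint := (isConnAlloc_bundle hf).1 j
  rcases lt_or_gt_of_ne hij with h | h
  · have hmax : ∀ w ∈ bundle f j, w ≤ (bundle f j).max' hj := fun w hw => Finset.le_max' _ w hw
    have hmem := Finset.max'_mem _ hj
    generalize (bundle f j).max' hj = v at hmax hmem
    have hfv := mem_bundle.1 hmem
    refine ⟨v, hmem, hint.sdiff_max hmax, ⟨j + 1, by omega⟩, fun a b hab => ?_,
      by simp [Fin.ext_iff], by simp only [Nat.dist]; omega⟩
    have hfab := hf hab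
    simp only [mem_bundle] at hmax
    simp only [Function.update_apply]
    split_ifs with ha hb hb
    · exact le_rfl
    · subst ha
      have : f b ≠ j := fun hbj => hb (le_antisymm (hmax b hbj) hab)
      rw [Fin.le_def]; simp only; omega
    · subst hb
      rw [Fin.le_def]; simp only; omega
    · exact hfab
  · have hmin : ∀ w ∈ bundle f j, (bundle f j).min' hj ≤ w := fun w hw => Finset.min'_le _ w hw
    have hmem := Finset.min'_mem _ hj
    generalize (bundle f j).min' hj = v at hmin hmem
    have hfv := mem_bundle.1 hmem
    refine ⟨v, hmem, hint.sdiff_min hmin, ⟨j - 1, by omega⟩, fun a b hab => ?_,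
      by simp only [ne_eq, Fin.ext_iff]; omega, by simp only [Nat.dist]; omega⟩
    have hfab := hf hab
    simp only [mem_bundle] at hmin
    simp only [Function.update_apply]
    split_ifs with ha hb hb
    · exact le_rfl
    · subst ha
      rw [Fin.le_def]; simp only; omega
    · subst hb
      have : f a ≠ j := fun haj => ha (le_antisymm hab (hmin a haj))
      rw [Fin.le_def]; simp only; omega
    · exact hfab

/-- If bundles of value at least `L` cannot all exceed `L`, some monotone assignment has all
bundles of value at least `L`, and at most `L` after removal of an outer item. -/
lemma exists_monotone_outer_le {n m : ℕ} {u : Finset (Fin m) → ℝ} (hmono : Monotonic u) {L : ℝ}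
    (hex : ∃ f : Fin m → Fin n, Monotone f ∧ ∀ i, L ≤ u (bundle f i))
    (hle : ∀ f : Fin m → Fin n, Monotone f → ∃ i, u (bundle f i) ≤ L) :
    ∃ f : Fin m → Fin n, Monotone f ∧ (∀ i, L ≤ u (bundle f i)) ∧
      ∀ j, (bundle f j).Nonempty →
        ∃ v ∈ bundle f j, IsInterval (bundle f j \ {v}) ∧ u (bundle f j \ {v}) ≤ L := by
  classical
  let G : Set (Fin m → Fin n) := {f | Monotone f ∧ ∀ i, L ≤ u (bundle f i)}
  let T : (Fin m → Fin n) → Finset (Fin n) := fun f =>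
    Finset.univ.filter fun i => u (bundle f i) ≤ L
  obtain ⟨f₀, hf₀, hmin₀⟩ := Set.exists_min_image G (fun f => (T f).card) (Set.toFinite _) hex
  obtain ⟨i, hi⟩ := hle f₀ hf₀.1
  obtain ⟨f, ⟨hfG, hfT⟩, hmin⟩ := Set.exists_min_image {f | f ∈ G ∧ T f = T f₀}
    (fun f => ∑ w, Nat.dist (f w : ℕ) i) (Set.toFinite _) ⟨f₀, hf₀, rfl⟩
  have hfi : u (bundle f i) ≤ L := by
    have : i ∈ T f := hfT ▸ by simpa [T] using hi
    simpa [T] using this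
  refine ⟨f, hfG.1, hfG.2, fun j hj => ?_⟩
  by_cases hji : j = i
  · subst hji
    exact ⟨_, Finset.max'_mem _ hj,
      ((isConnAlloc_bundle hfG.1).1 j).sdiff_max fun w hw => Finset.le_max' _ w hw,
      (hmono _ _ Finset.sdiff_subset).trans hfi⟩
  obtain ⟨v, hv, hint, k, hk, hkj, hdist⟩ := exists_outer_move hfG.1 hji hj
  refine ⟨v, hv, hint, ?_⟩
  by_contra! hlt
  rw [mem_bundle] at hv
  have hbj : bundle (Function.update f v k) j = bundle f j \ {v} := by
    ext w
    by_cases hw : w = v <;> simp [mem_bundle, hw, hkj]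
  have hsub : ∀ l, l ≠ j → bundle f l ⊆ bundle (Function.update f v k) l := by
    intro l hl w hw
    rw [mem_bundle] at *
    have : w ≠ v := by
      rintro rfl
      exact hl (hw.symm.trans hv)
    rwa [Function.update_of_ne this]
  have hG : Function.update f v k ∈ G := by
    refine ⟨hk, fun l => ?_⟩
    by_cases hl : l = j
    · rw [hl, hbj]
      exact hlt.le
    · exact (hfG.2 l).trans (hmono _ _ (hsub l hl))
  have hT : T (Function.update f v k) ⊆ T f₀ := by
    rw [← hfT]
    intro l hl
    simp only [T, Finset.mem_filter, Finset.mem_univ, true_and] at *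
    by_cases hlj : l = j
    · rw [hlj, hbj] at hl
      exact absurd hl hlt.not_ge
    · exact (hmono _ _ (hsub l hlj)).trans hl
  refine (hmin _ ⟨hG, Finset.eq_of_subset_of_card_le hT (hmin₀ _ hG)⟩).not_gt ?_
  refine Finset.sum_lt_sum (fun w _ => ?_) ⟨v, Finset.mem_univ v, ?_⟩
  · by_cases hw : w = v
    · simpa [hw, hv] using hdist.le
    · simp [Function.update_of_ne hw]
  · simpa [hv] using hdist

/-- on a path of `m` items, for any number `n ≥ 1` of agents sharing one
identical monotonic valuation `u`, there is a connected allocation that is simultaneously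
EF1 and MMS. -/
theorem EF1_and_MMS_identical {n m : ℕ} (hn : 0 < n)
    (u : Finset (Fin m) → ℝ) (hmono : Monotonic u) (h0 : u ∅ = 0) :
    ∃ A : Fin n → Finset (Fin m), IsConnAlloc A ∧ EF1 (fun _ => u) A ∧
      ∀ i : Fin n, MMS n u ≤ u (A i) := by
  obtain ⟨f, hf, hL, hout⟩ := exists_monotone_outer_le hmono (exists_monotone_MMS_le hn u)
    fun f hf => (isConnAlloc_bundle hf).exists_le_MMS hn u
  refine ⟨bundle f, isConnAlloc_bundle hf, fun i j => ?_, hL⟩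
  refine (Finset.eq_empty_or_nonempty (bundle f j)).imp_right fun hj => ?_
  obtain ⟨v, hv, hint, hvL⟩ := hout j hj
  exact ⟨v, hv, hint, hvL.trans (hL i)⟩
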